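/- Edge limit for class AI†: fix y ∈ ℝ and c ∈ ℂ, and set x_N := N + √(2N)·y + c. Then lim_{N→∞} √N · e^{−x_N} · [E_N(x_N) − (x_N/(N+1)) · E_{N−1}(x_N)] = (1/√(2π)) · e^{−y²} − (y/√2) · erfc(y). -/

import Mathlib

open Filter Finset MeasureTheory

/-- The truncated exponential `E_n(x) = ∑_{j=0}^n x^j/j!`. -/
noncomputable def truncExp (n : ℕ) (x : ℂ) : ℂ :=
  ∑ j ∈ Finset.range (n + 1), x ^ j / (Nat.factorial j : ℂ)

/-- The complementary error function `erfc(y) = (2/√π) ∫_y^∞ e^{−t²} dt`. -/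
noncomputable def erfc (y : ℝ) : ℝ :=
  (2 / Real.sqrt Real.pi) * ∫ t in Set.Ioi y, Real.exp (-t ^ 2)

open Topology

/-- The density `e^{-x} x^N / N!` of the Gamma distribution, as an entire function. -/
noncomputable def gammaDensity (N : ℕ) (x : ℂ) : ℂ :=
  Complex.exp (-x) * (x ^ N / (Nat.factorial N : ℂ))

/-- The point `N + √(2N) y + c` near the edge of the spectrum. -/
noncomputable def edgePoint (N : ℕ) (y : ℝ) (c : ℂ) : ℂ :=
  (N : ℂ) + (Real.sqrt (2 * N) : ℝ) * (y : ℂ) + c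

theorem norm_one_add_mul_exp_neg_sub_le {z : ℂ} (hz : ‖z‖ ≤ 1) :
    ‖(1 + z) * Complex.exp (-z) - 1 + z ^ 2 / 2‖ ≤ 3 * ‖z‖ ^ 3 := by
  have h := Complex.exp_bound (x := -z) (by simpa using hz) (n := 3) (by norm_num)
  simp only [Finset.sum_range_succ, Finset.sum_range_zero, norm_neg] at h
  norm_num [Nat.factorial] at h
  have h3 : 0 ≤ ‖z‖ ^ 3 := by positivity
  have e : (1 + z) * Complex.exp (-z) - 1 + z ^ 2 / 2
      = (1 + z) * (Complex.exp (-z) - (1 + -z + z ^ 2 / 2)) + z ^ 3 / 2 := by ring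
  have h1 : ‖1 + z‖ ≤ 2 := (norm_add_le _ _).trans (by rw [norm_one]; linarith)
  rw [e]
  calc _ ≤ ‖1 + z‖ * ‖Complex.exp (-z) - (1 + -z + z ^ 2 / 2)‖ + ‖z ^ 3 / 2‖ := by
        rw [← norm_mul]; exact norm_add_le _ _
    _ ≤ 2 * (‖z‖ ^ 3 * (2 / 9)) + ‖z‖ ^ 3 / 2 := by
        gcongr
        simp
    _ ≤ _ := by linarith

theorem tendsto_one_add_pow_mul_exp_neg {z : ℕ → ℂ} {a : ℂ} (hz : Tendsto z atTop (𝓝 0))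
    (ha : Tendsto (fun N : ℕ => (N : ℂ) * z N ^ 2) atTop (𝓝 a)) :
    Tendsto (fun N : ℕ => ((1 + z N) * Complex.exp (-z N)) ^ N) atTop
      (𝓝 (Complex.exp (-a / 2))) := by
  have hR : Tendsto (fun N : ℕ =>
      (N : ℂ) * ((1 + z N) * Complex.exp (-z N) - 1 + z N ^ 2 / 2)) atTop (𝓝 0) := by
    have hb : Tendsto (fun N : ℕ => 3 * ‖(N : ℂ) * z N ^ 2‖ * ‖z N‖) atTop (𝓝 0) := by
      simpa using (ha.norm.const_mul 3).mul hz.norm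
    refine squeeze_zero_norm' ?_ hb
    have hz1 : ∀ᶠ N in atTop, ‖z N‖ < 1 := hz.norm.eventually_lt_const (by simp)
    filter_upwards [hz1] with N hN
    rw [norm_mul, norm_mul, norm_pow]
    calc _ ≤ ‖(N : ℂ)‖ * (3 * ‖z N‖ ^ 3) := by
          gcongr
          exact norm_one_add_mul_exp_neg_sub_le hN.le
      _ = _ := by ring
  have h := Complex.tendsto_one_add_pow_exp_of_tendsto
    (g := fun N => (1 + z N) * Complex.exp (-z N) - 1) (t := -a / 2) (by
      have := hR.sub (ha.div_const 2)
      rw [zero_sub, ← neg_div] at this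
      refine this.congr fun N => ?_
      ring)
  simpa using h

theorem tendsto_sqrt_two_mul_stirling :
    Tendsto (fun N : ℕ => Real.sqrt (2 * N) * Real.exp (-N) * (N : ℝ) ^ N / Nat.factorial N)
      atTop (𝓝 (1 / Real.sqrt Real.pi)) := by
  have h := Stirling.tendsto_stirlingSeq_sqrt_pi.inv₀ (by positivity)
  rw [one_div]
  refine h.congr fun N => ?_
  rw [Stirling.stirlingSeq, inv_div, div_pow, ← Real.exp_nat_mul, mul_one, Real.exp_neg]
  ring

theorem gammaDensity_mul_one_add (N : ℕ) (z : ℂ) :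
    gammaDensity N (N * (1 + z)) =
      ((Real.exp (-N) * (N : ℝ) ^ N / Nat.factorial N : ℝ) : ℂ) *
        ((1 + z) * Complex.exp (-z)) ^ N := by
  rw [gammaDensity, mul_pow, mul_pow, ← Complex.exp_nat_mul]
  push_cast
  rw [show -((N : ℂ) * (1 + z)) = -N + N * -z by ring, Complex.exp_add]
  ring

theorem edgePoint_eq {N : ℕ} (hN : N ≠ 0) (y : ℝ) (c : ℂ) :
    edgePoint N y c = N * (1 + ((Real.sqrt (2 / N) * y : ℝ) + c / N)) := by
  have hN' : (N : ℂ) ≠ 0 := by exact_mod_cast hN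
  have h : (N : ℝ) * Real.sqrt (2 / N) = Real.sqrt (2 * N) := by
    rw [show (2 * N : ℝ) = N ^ 2 * (2 / N) by field_simp, Real.sqrt_mul (by positivity),
      Real.sqrt_sq (by positivity)]
  rw [edgePoint, ← h]
  push_cast
  field_simp
  ring

theorem tendsto_sqrt_two_div : Tendsto (fun N : ℕ => Real.sqrt (2 / N)) atTop (𝓝 0) := by
  simpa using (tendsto_const_div_atTop_nhds_zero_nat (2 : ℝ)).sqrt

theorem tendsto_sqrt_two_mul_gammaDensity (y : ℝ) (c : ℂ) :
    Tendsto (fun N : ℕ => (Real.sqrt (2 * N) : ℂ) * gammaDensity N (edgePoint N y c)) atTop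
      (𝓝 ((1 / Real.sqrt Real.pi * Real.exp (-y ^ 2) : ℝ) : ℂ)) := by
  have hs : Tendsto (fun N : ℕ => ((Real.sqrt (2 / N) * y : ℝ) : ℂ)) atTop (𝓝 0) := by
    simpa only [zero_mul, Complex.ofReal_zero] using (tendsto_sqrt_two_div.mul_const y).ofReal
  have hc : Tendsto (fun N : ℕ => c / (N : ℂ)) atTop (𝓝 0) :=
    tendsto_const_div_atTop_nhds_zero_nat c
  have hsum := hs.add hc
  rw [add_zero] at hsum
  have hsq : Tendsto (fun N : ℕ => (N : ℂ) * (((Real.sqrt (2 / N) * y : ℝ) : ℂ) + c / N) ^ 2)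
      atTop (𝓝 (2 * y ^ 2)) := by
    have h : Tendsto (fun N : ℕ => 2 * (y : ℂ) ^ 2 + 2 * c * ((Real.sqrt (2 / N) * y : ℝ) : ℂ)
        + c * (c / N)) atTop (𝓝 (2 * y ^ 2 + 2 * c * 0 + c * 0)) :=
      (tendsto_const_nhds.add (hs.const_mul _)).add (hc.const_mul _)
    simp only [mul_zero, add_zero] at h
    refine h.congr' ?_
    filter_upwards [eventually_ne_atTop 0] with N hN
    have hN' : (N : ℂ) ≠ 0 := by exact_mod_cast hN
    have hq : ((Real.sqrt (2 / N) : ℝ) : ℂ) ^ 2 = 2 / N := by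
      rw [← Complex.ofReal_pow, Real.sq_sqrt (by positivity)]
      simp
    have e : (N : ℂ) * (((Real.sqrt (2 / N) * y : ℝ) : ℂ) + c / N) ^ 2
        = N * ((Real.sqrt (2 / N) : ℝ) : ℂ) ^ 2 * y ^ 2
          + 2 * c * ((Real.sqrt (2 / N) * y : ℝ) : ℂ) * (N / N) + c * (c / N) * (N / N) := by
      push_cast
      ring
    rw [e, hq, div_self hN', mul_div_cancel₀ _ hN']
    ring
  have h := tendsto_sqrt_two_mul_stirling.ofReal.mul
    (tendsto_one_add_pow_mul_exp_neg hsum hsq)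
  have e : Complex.exp (-(2 * (y : ℂ) ^ 2) / 2) = ((Real.exp (-y ^ 2) : ℝ) : ℂ) := by
    push_cast
    congr 1
    ring
  rw [e, ← Complex.ofReal_mul] at h
  refine h.congr' ?_
  filter_upwards [eventually_ne_atTop 0] with N hN
  rw [edgePoint_eq hN, gammaDensity_mul_one_add, ← mul_assoc,
    ← Complex.ofReal_mul]
  congr 3
  ring

theorem tendsto_gammaDensity (y : ℝ) (c : ℂ) :
    Tendsto (fun N : ℕ => gammaDensity N (edgePoint N y c)) atTop (𝓝 0) := by
  have hi : Tendsto (fun N : ℕ => ((Real.sqrt (2 * N))⁻¹ : ℝ)) atTop (𝓝 0) :=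
    (Real.tendsto_sqrt_atTop.comp
      (tendsto_natCast_atTop_atTop.const_mul_atTop (by norm_num))).inv_tendsto_atTop
  have h := hi.ofReal.mul (tendsto_sqrt_two_mul_gammaDensity y c)
  rw [Complex.ofReal_zero, zero_mul] at h
  refine h.congr' ?_
  filter_upwards [eventually_ne_atTop 0] with N hN
  have : (Real.sqrt (2 * N) : ℂ) ≠ 0 := by
    have : 0 < (N : ℝ) := by positivity
    exact_mod_cast (by positivity : Real.sqrt (2 * N) ≠ 0)
  rw [Complex.ofReal_inv]
  field_simp

theorem hasDerivAt_truncExp_succ (n : ℕ) (x : ℂ) :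
    HasDerivAt (truncExp (n + 1)) (truncExp n x) x := by
  have h : HasDerivAt (fun x : ℂ => ∑ j ∈ range (n + 2), x ^ j / (Nat.factorial j : ℂ))
      (∑ j ∈ range (n + 2), (j : ℂ) * x ^ (j - 1) / (Nat.factorial j : ℂ)) x :=
    HasDerivAt.fun_sum fun j _ => (hasDerivAt_pow j x).div_const _
  refine h.congr_deriv ?_
  rw [truncExp, Finset.sum_range_succ' _ (n + 1)]
  simp only [Nat.cast_zero, zero_mul, zero_div, add_zero, Nat.add_sub_cancel]
  refine Finset.sum_congr rfl fun j _ => ?_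
  have : ((j : ℂ) + 1) ≠ 0 := by exact_mod_cast j.succ_ne_zero
  rw [Nat.factorial_succ]
  push_cast
  rw [mul_div_mul_left _ _ this]

theorem truncExp_succ (n : ℕ) (x : ℂ) :
    truncExp (n + 1) x = truncExp n x + x ^ (n + 1) / (Nat.factorial (n + 1) : ℂ) :=
  Finset.sum_range_succ _ _

theorem hasDerivAt_exp_neg_mul_truncExp (n : ℕ) (x : ℂ) :
    HasDerivAt (fun x => Complex.exp (-x) * truncExp n x) (-gammaDensity n x) x := by
  have he : HasDerivAt (fun x : ℂ => Complex.exp (-x)) (Complex.exp (-x) * -1) x :=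
    (hasDerivAt_neg x).cexp
  cases n with
  | zero =>
    have h0 : truncExp 0 = fun _ => 1 := by
      ext
      simp [truncExp]
    simpa [h0, gammaDensity] using he
  | succ n =>
    refine (he.mul (hasDerivAt_truncExp_succ n x)).congr_deriv ?_
    rw [truncExp_succ, gammaDensity]
    ring

theorem tendsto_exp_neg_mul_truncExp (n : ℕ) :
    Tendsto (fun t : ℝ => Complex.exp (-(t : ℂ)) * truncExp n t) atTop (𝓝 0) := by
  have h : Tendsto (fun t : ℝ => ((∑ j ∈ range (n + 1),
      t ^ j * Real.exp (-t) / (Nat.factorial j : ℝ) : ℝ) : ℂ)) atTop (𝓝 0) := by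
    have h' : Tendsto (fun t : ℝ => ∑ j ∈ range (n + 1),
        t ^ j * Real.exp (-t) / (Nat.factorial j : ℝ)) atTop (𝓝 0) := by
      rw [show (0 : ℝ) = ∑ j ∈ range (n + 1), 0 / (Nat.factorial j : ℝ) by simp]
      exact tendsto_finsetSum _ fun j _ =>
        (Real.tendsto_pow_mul_exp_neg_atTop_nhds_zero j).div_const _
    simpa only [Complex.ofReal_zero] using h'.ofReal
  refine h.congr fun t => ?_
  rw [truncExp, Finset.mul_sum]
  push_cast
  exact Finset.sum_congr rfl fun j _ => by ring

theorem one_add_mul_exp_neg_pow_le {N : ℕ} (hN : N ≠ 0) {s : ℝ}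
    (hs : 0 ≤ 1 + Real.sqrt (2 / N) * s) :
    ((1 + Real.sqrt (2 / N) * s) * Real.exp (-(Real.sqrt (2 / N) * s))) ^ N
      ≤ Real.exp (2 / 3 * (1 - s)) := by
  have hN1 : (1 : ℝ) ≤ N := by exact_mod_cast Nat.one_le_iff_ne_zero.2 hN
  have hN0 : (N : ℝ) ≠ 0 := by positivity
  set v := Real.sqrt (2 / N) with hv
  have hv0 : 0 ≤ v := Real.sqrt_nonneg _
  have hv2 : N * v ^ 2 = 2 := by
    rw [hv, Real.sq_sqrt (by positivity)]
    field_simp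
  have hvle : v ≤ 2 := by nlinarith
  rcases le_total s 1 with h | h
  · have h1 : (1 + v * s) * Real.exp (-(v * s)) ≤ 1 := by
      rw [Real.exp_neg, ← div_eq_mul_inv, div_le_one (Real.exp_pos _), add_comm]
      exact Real.add_one_le_exp _
    exact (pow_le_one₀ (by positivity) h1).trans (Real.one_le_exp (by linarith))
  · have h1 : 1 + v * s ≤ Real.exp v * Real.exp (v * (s - 1) / (1 + v)) := by
      calc 1 + v * s = (1 + v) * (v * (s - 1) / (1 + v) + 1) := by
            field_simp
            ring
        _ ≤ _ := mul_le_mul (by linarith [Real.add_one_le_exp v]) (Real.add_one_le_exp _)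
            (by have : 0 ≤ s - 1 := by linarith
                positivity) (Real.exp_nonneg _)
    calc _ ≤ (Real.exp v * Real.exp (v * (s - 1) / (1 + v)) * Real.exp (-(v * s))) ^ N := by
          gcongr
      _ = Real.exp (-(N * v ^ 2 * (s - 1) / (1 + v))) := by
          rw [← Real.exp_add, ← Real.exp_add, ← Real.exp_nat_mul]
          congr 1
          field_simp
          ring
      _ ≤ _ := by
          rw [hv2]
          refine Real.exp_le_exp.2 ?_
          have : 2 / 3 * (s - 1) ≤ 2 * (s - 1) / (1 + v) := by
            rw [le_div_iff₀ (by positivity)]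
            nlinarith
          linarith

theorem eventually_norm_sqrt_two_mul_gammaDensity_le (y : ℝ) :
    ∀ᶠ N : ℕ in atTop, ∀ s ∈ Set.Ioi y,
      ‖(Real.sqrt (2 * N) : ℂ) * gammaDensity N (edgePoint N s 0)‖
        ≤ Real.exp (2 / 3 * (1 - s)) := by
  have hy : ∀ᶠ N : ℕ in atTop, -1 < Real.sqrt (2 / N) * y := by
    refine (tendsto_sqrt_two_div.mul_const y).eventually_const_lt ?_
    norm_num
  have hK : ∀ᶠ N : ℕ in atTop,
      Real.sqrt (2 * N) * Real.exp (-N) * (N : ℝ) ^ N / Nat.factorial N < 1 := by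
    refine tendsto_sqrt_two_mul_stirling.eventually_lt_const ?_
    rw [div_lt_one (by positivity), Real.lt_sqrt (by norm_num)]
    linarith [Real.pi_gt_three]
  filter_upwards [hy, hK, eventually_ne_atTop 0] with N hy hK hN s hs
  have hs' : 0 ≤ 1 + Real.sqrt (2 / N) * s := by
    have := mul_le_mul_of_nonneg_left (le_of_lt hs) (Real.sqrt_nonneg (2 / N))
    linarith
  have e : (Real.sqrt (2 * N) : ℂ) * gammaDensity N (edgePoint N s 0)
      = ((Real.sqrt (2 * N) * Real.exp (-N) * (N : ℝ) ^ N / Nat.factorial N *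
        ((1 + Real.sqrt (2 / N) * s) * Real.exp (-(Real.sqrt (2 / N) * s))) ^ N : ℝ) : ℂ) := by
    rw [edgePoint_eq hN, gammaDensity_mul_one_add]
    push_cast
    rw [zero_div, add_zero]
    ring
  rw [e, Complex.norm_real, Real.norm_of_nonneg (by positivity)]
  calc _ ≤ 1 * Real.exp (2 / 3 * (1 - s)) := by
        gcongr
        exact one_add_mul_exp_neg_pow_le hN hs'
    _ = _ := one_mul _

theorem integrableOn_exp_two_thirds (y : ℝ) :
    IntegrableOn (fun s : ℝ => Real.exp (2 / 3 * (1 - s))) (Set.Ioi y) := by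
  have h : IntegrableOn (fun s : ℝ => Real.exp (2 / 3) * Real.exp (-(2 / 3) * s)) (Set.Ioi y) :=
    (integrableOn_exp_mul_Ioi (by norm_num) y).const_mul _
  refine h.congr_fun (fun s _ => ?_) measurableSet_Ioi
  simp only [← Real.exp_add]
  congr 1
  ring

theorem continuous_gammaDensity_edgePoint (N : ℕ) :
    Continuous fun s : ℝ => (Real.sqrt (2 * N) : ℂ) * gammaDensity N (edgePoint N s 0) := by
  unfold gammaDensity edgePoint
  fun_prop

theorem tendsto_exp_neg_mul_truncExp_edgePoint_zero (y : ℝ) :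
    Tendsto (fun N : ℕ => Complex.exp (-edgePoint N y 0) * truncExp N (edgePoint N y 0)) atTop
      (𝓝 ((erfc y / 2 : ℝ) : ℂ)) := by
  have hb := eventually_norm_sqrt_two_mul_gammaDensity_le y
  have hlim := tendsto_integral_filter_of_dominated_convergence (l := atTop)
    (μ := volume.restrict (Set.Ioi y))
    (F := fun (N : ℕ) (s : ℝ) => (Real.sqrt (2 * N) : ℂ) * gammaDensity N (edgePoint N s 0))
    (f := fun s => ((1 / Real.sqrt Real.pi * Real.exp (-s ^ 2) : ℝ) : ℂ))
    (fun s => Real.exp (2 / 3 * (1 - s)))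
    (Eventually.of_forall fun N => (continuous_gammaDensity_edgePoint N).aestronglyMeasurable)
    (hb.mono fun N hN => ae_restrict_of_forall_mem measurableSet_Ioi hN)
    (integrableOn_exp_two_thirds y)
    (Eventually.of_forall fun s => tendsto_sqrt_two_mul_gammaDensity s 0)
  rw [integral_complex_ofReal, integral_const_mul] at hlim
  have e : 1 / Real.sqrt Real.pi * ∫ s in Set.Ioi y, Real.exp (-s ^ 2) = erfc y / 2 := by
    rw [erfc]
    ring
  rw [e] at hlim
  refine hlim.congr' ?_
  filter_upwards [hb, eventually_ne_atTop 0] with N hN hN0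
  have hN1 : 0 < (N : ℝ) := by positivity
  have hedge (s : ℝ) : edgePoint N s 0 = ((N + Real.sqrt (2 * N) * s : ℝ) : ℂ) := by
    simp [edgePoint]
  have hd (s : ℝ) : HasDerivAt
      (fun s : ℝ => -(Complex.exp (-edgePoint N s 0) * truncExp N (edgePoint N s 0)))
      ((Real.sqrt (2 * N) : ℂ) * gammaDensity N (edgePoint N s 0)) s := by
    have h1 : HasDerivAt (fun s : ℝ => edgePoint N s 0) (Real.sqrt (2 * N) : ℂ) s := by
      simpa [edgePoint] using
        (((hasDerivAt_id s).ofReal_comp.const_mul (Real.sqrt (2 * N) : ℂ)).const_add (N : ℂ))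
    refine ((hasDerivAt_exp_neg_mul_truncExp N (edgePoint N s 0)).comp s h1).neg.congr_deriv ?_
    ring
  have ht : Tendsto
      (fun s : ℝ => -(Complex.exp (-edgePoint N s 0) * truncExp N (edgePoint N s 0)))
      atTop (𝓝 0) := by
    have h2 : Tendsto (fun s : ℝ => N + Real.sqrt (2 * N) * s) atTop atTop :=
      tendsto_atTop_add_const_left _ _ (tendsto_id.const_mul_atTop (by positivity))
    simp only [hedge]
    simpa using ((tendsto_exp_neg_mul_truncExp N).comp h2).neg
  have hi : IntegrableOn
      (fun s : ℝ => (Real.sqrt (2 * N) : ℂ) * gammaDensity N (edgePoint N s 0)) (Set.Ioi y) :=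
    (integrableOn_exp_two_thirds y).mono'
      (continuous_gammaDensity_edgePoint N).aestronglyMeasurable
      (ae_restrict_of_forall_mem measurableSet_Ioi hN)
  rw [integral_Ioi_of_hasDerivAt_of_tendsto' (fun s _ => hd s) hi ht]
  ring

theorem tendsto_exp_neg_mul_truncExp_edgePoint (y : ℝ) (c : ℂ) :
    Tendsto (fun N : ℕ => Complex.exp (-edgePoint N y c) * truncExp N (edgePoint N y c)) atTop
      (𝓝 ((erfc y / 2 : ℝ) : ℂ)) := by
  suffices h : Tendsto (fun N : ℕ => Complex.exp (-edgePoint N y c) * truncExp N (edgePoint N y c)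
      - Complex.exp (-edgePoint N y 0) * truncExp N (edgePoint N y 0)) atTop (𝓝 0) by
    simpa using h.add (tendsto_exp_neg_mul_truncExp_edgePoint_zero y)
  have hg := ((tendsto_gammaDensity y (‖c‖ : ℂ)).norm.const_mul (Real.exp (2 * ‖c‖))).mul_const ‖c‖
  rw [norm_zero, mul_zero, zero_mul] at hg
  refine squeeze_zero_norm' ?_ hg
  have hy : ∀ᶠ N : ℕ in atTop, -1 < Real.sqrt (2 / N) * y := by
    refine (tendsto_sqrt_two_div.mul_const y).eventually_const_lt ?_
    norm_num
  filter_upwards [hy, eventually_ne_atTop 0] with N hN hN0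
  set r : ℝ := N * (1 + Real.sqrt (2 / N) * y) with hr
  have hr0 : 0 ≤ r := mul_nonneg (by positivity) (by linarith)
  have hadd (w : ℂ) : edgePoint N y w = r + w := by
    have : (N : ℂ) ≠ 0 := by exact_mod_cast hN0
    rw [edgePoint_eq hN0, hr]
    push_cast
    field_simp
    ring
  have hnorm : ‖gammaDensity N (edgePoint N y (‖c‖ : ℂ))‖
      = Real.exp (-(r + ‖c‖)) * ((r + ‖c‖) ^ N / Nat.factorial N) := by
    rw [hadd, ← Complex.ofReal_add, gammaDensity, norm_mul, norm_div, norm_pow, Complex.norm_exp,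
      Complex.norm_real, Real.norm_of_nonneg (by positivity)]
    simp
  have hbound : ∀ x ∈ Metric.closedBall (r : ℂ) ‖c‖, ‖-gammaDensity N x‖
      ≤ Real.exp (2 * ‖c‖) * ‖gammaDensity N (edgePoint N y (‖c‖ : ℂ))‖ := by
    intro x hx
    rw [mem_closedBall_iff_norm] at hx
    have hx1 : ‖x‖ ≤ r + ‖c‖ := by
      have := norm_add_le (r : ℂ) (x - r)
      rw [add_sub_cancel, Complex.norm_real, Real.norm_of_nonneg hr0] at this
      linarith
    have hx2 : (-x).re ≤ 2 * ‖c‖ + -(r + ‖c‖) := by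
      have := (Complex.abs_re_le_norm (x - r)).trans hx
      have := (abs_le.1 this).1
      simp only [Complex.sub_re, Complex.ofReal_re] at this
      simp only [Complex.neg_re]
      linarith
    rw [hnorm, norm_neg, gammaDensity, norm_mul, norm_div, norm_pow, Complex.norm_exp,
      ← mul_assoc, ← Real.exp_add, Complex.norm_natCast]
    gcongr
  have h := (convex_closedBall (r : ℂ) ‖c‖).norm_image_sub_le_of_norm_hasDerivWithin_le
    (fun x _ => (hasDerivAt_exp_neg_mul_truncExp N x).hasDerivWithinAt) hbound
    (Metric.mem_closedBall_self (norm_nonneg c)) (show (r : ℂ) + c ∈ _ by simp)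
  rw [hadd c, hadd 0, add_zero]
  simpa using h

theorem tendsto_sqrt_mul_one_sub_edgePoint_div (y : ℝ) (c : ℂ) :
    Tendsto (fun N : ℕ => (Real.sqrt N : ℂ) * (1 - edgePoint N y c / ((N : ℂ) + 1))) atTop
      (𝓝 ((-(Real.sqrt 2 * y) : ℝ) : ℂ)) := by
  have hq : Tendsto (fun N : ℕ => ((N / (N + 1) : ℝ) : ℂ)) atTop (𝓝 1) := by
    simpa only [Complex.ofReal_one] using (tendsto_natCast_div_add_atTop (1 : ℝ)).ofReal
  have hi : Tendsto (fun N : ℕ => (((Real.sqrt N)⁻¹ : ℝ) : ℂ)) atTop (𝓝 0) := by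
    rw [← Complex.ofReal_zero]
    exact (Real.tendsto_sqrt_atTop.comp tendsto_natCast_atTop_atTop).inv_tendsto_atTop.ofReal
  have h := hq.mul ((hi.const_mul (1 - c)).sub_const ((Real.sqrt 2 * y : ℝ) : ℂ))
  rw [mul_zero, zero_sub, one_mul, ← Complex.ofReal_neg] at h
  refine h.congr' ?_
  filter_upwards [eventually_ne_atTop 0] with N hN
  have hs : (Real.sqrt N : ℂ) ≠ 0 := by
    have : 0 < (N : ℝ) := by positivity
    exact_mod_cast (by positivity : Real.sqrt N ≠ 0)
  have hN1 : (N : ℂ) + 1 ≠ 0 := by exact_mod_cast N.succ_ne_zero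
  have hsq : (N : ℂ) = (Real.sqrt N : ℂ) ^ 2 := by
    rw [← Complex.ofReal_pow, Real.sq_sqrt (by positivity), Complex.ofReal_natCast]
  rw [edgePoint, Real.sqrt_mul (by norm_num)]
  push_cast
  generalize (Real.sqrt N : ℂ) = q at *
  rw [hsq] at hN1 ⊢
  field_simp
  ring

/-- Edge limit for class AI† (complex symmetric): with `x_N = N + √(2N) y + c`,
`√N e^{−x_N} [E_N(x_N) − (x_N/(N+1)) E_{N−1}(x_N)] → (1/√(2π)) e^{−y²} − (y/√2) erfc(y)`. -/
theorem statement9 (y : ℝ) (c : ℂ) :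
    Tendsto (fun N : ℕ =>
        (Real.sqrt N : ℂ) *
          Complex.exp (-((N : ℂ) + (Real.sqrt (2 * N) : ℝ) * (y : ℂ) + c)) *
          (truncExp N ((N : ℂ) + (Real.sqrt (2 * N) : ℝ) * (y : ℂ) + c) -
            (((N : ℂ) + (Real.sqrt (2 * N) : ℝ) * (y : ℂ) + c) / ((N : ℂ) + 1)) *
              truncExp (N - 1) ((N : ℂ) + (Real.sqrt (2 * N) : ℝ) * (y : ℂ) + c)))
      atTop
      (nhds (((1 / Real.sqrt (2 * Real.pi)) * Real.exp (-y ^ 2) -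
        (y / Real.sqrt 2) * erfc y : ℝ) : ℂ)) := by
  change Tendsto (fun N : ℕ => (Real.sqrt N : ℂ) * Complex.exp (-edgePoint N y c) *
    (truncExp N (edgePoint N y c) - edgePoint N y c / ((N : ℂ) + 1) *
      truncExp (N - 1) (edgePoint N y c))) atTop _
  have h := ((tendsto_sqrt_mul_one_sub_edgePoint_div y c).mul
    ((tendsto_exp_neg_mul_truncExp_edgePoint y c).sub (tendsto_gammaDensity y c))).add
    ((tendsto_sqrt_two_mul_gammaDensity y c).const_mul ((Real.sqrt 2)⁻¹ : ℂ))
  have hlim : ((-(Real.sqrt 2 * y) : ℝ) : ℂ) * (((erfc y / 2 : ℝ) : ℂ) - 0)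
      + (Real.sqrt 2 : ℂ)⁻¹ * ((1 / Real.sqrt Real.pi * Real.exp (-y ^ 2) : ℝ) : ℂ)
      = ((1 / Real.sqrt (2 * Real.pi) * Real.exp (-y ^ 2) - y / Real.sqrt 2 * erfc y : ℝ) : ℂ) := by
    rw [sub_zero, ← Complex.ofReal_inv, ← Complex.ofReal_mul, ← Complex.ofReal_mul,
      ← Complex.ofReal_add, Real.sqrt_mul (by norm_num)]
    congr 1
    have h2 : Real.sqrt 2 ^ 2 = 2 := Real.sq_sqrt (by norm_num)
    field_simp
    rw [h2]
    ring
  rw [hlim] at h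
  refine h.congr' ?_
  filter_upwards [eventually_ne_atTop 0] with N hN
  obtain ⟨n, rfl⟩ := Nat.exists_eq_succ_of_ne_zero hN
  have h2 : (Real.sqrt 2 : ℂ) ≠ 0 := by exact_mod_cast (by positivity : Real.sqrt 2 ≠ 0)
  rw [Nat.succ_eq_add_one, Nat.add_sub_cancel, Real.sqrt_mul (by norm_num), Complex.ofReal_mul,
    mul_assoc (Real.sqrt 2 : ℂ), inv_mul_cancel_left₀ h2, truncExp_succ, gammaDensity]
  ring
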